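/- arXiv:2409.06350 — 3 statements merged into one kernel-verified Lean document; each statement's English description precedes it below -/
import Mathlib

section
/- For every even integer n ≥ 6, the group EM_n is generated by the two elements a = σ_{n-3}·T·α₀·σ_{n-3}⁻¹ and b = T·σ_{n-1}⁻¹·α₂ (that is, the subgroup of EM_n generated by {a, b} is all of EM_n). -/
/-!
The extended mapping class group `EM n` of the `n`-punctured sphere, presented with
generators `σ₁, …, σ_{n-1}`, `T` and relations:
`T² = 1`; `(T σᵢ)² = 1`; `σᵢσⱼ = σⱼσᵢ` for `|i - j| ≥ 2`;
`σᵢσⱼσᵢ = σⱼσᵢσⱼ` for `|i - j| = 1`;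
`σ₁⋯σ_{n-1} σ_{n-1}⋯σ₁ = 1`; `(σ₁⋯σ_{n-1})ⁿ = 1`.
-/

namespace SphereEMCG

/-- Generators: `none` is the reflection `T`; `some i` is the half-twist `σ_{i+1}`. -/
abbrev Gen (n : ℕ) := Option (Fin (n - 1))

/-- The generator `T` as an element of the free group. -/
def Tf (n : ℕ) : FreeGroup (Gen n) := FreeGroup.of (none : Gen n)

/-- The generator `σ_i` (for `1 ≤ i ≤ n - 1`) as an element of the free group. -/
def σf (n : ℕ) (i : ℕ) : FreeGroup (Gen n) :=
  if h : 1 ≤ i ∧ i ≤ n - 1 then FreeGroup.of (some ⟨i - 1, by omega⟩) else 1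

/-- The word `σ_a σ_{a+1} ⋯ σ_b` in the free group. -/
def σfProd (n : ℕ) (a b : ℕ) : FreeGroup (Gen n) :=
  ((List.range' a (b + 1 - a)).map (σf n)).prod

/-- The word `σ_b σ_{b-1} ⋯ σ_a` in the free group. -/
def σfProdRev (n : ℕ) (a b : ℕ) : FreeGroup (Gen n) :=
  ((List.range' a (b + 1 - a)).reverse.map (σf n)).prod

/-- The defining relations of the extended mapping class group of the
`n`-punctured sphere. -/
def rels (n : ℕ) : Set (FreeGroup (Gen n)) :=
  { r | r = Tf n * Tf n
      ∨ (∃ i, 1 ≤ i ∧ i ≤ n - 1 ∧ r = (Tf n * σf n i) * (Tf n * σf n i))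
      ∨ (∃ i j, 1 ≤ i ∧ i ≤ n - 1 ∧ 1 ≤ j ∧ j ≤ n - 1 ∧ (i + 2 ≤ j ∨ j + 2 ≤ i) ∧
          r = σf n i * σf n j * (σf n j * σf n i)⁻¹)
      ∨ (∃ i j, 1 ≤ i ∧ i ≤ n - 1 ∧ 1 ≤ j ∧ j ≤ n - 1 ∧ (i + 1 = j ∨ j + 1 = i) ∧
          r = σf n i * σf n j * σf n i * (σf n j * σf n i * σf n j)⁻¹)
      ∨ r = σfProd n 1 (n - 1) * σfProdRev n 1 (n - 1)
      ∨ r = (σfProd n 1 (n - 1)) ^ n }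

/-- The extended mapping class group of the `n`-punctured sphere, by its
standard presentation. -/
abbrev EM (n : ℕ) := PresentedGroup (rels n)

/-- The orientation-reversing mapping class `T` in `EM n`. -/
def T (n : ℕ) : EM n := PresentedGroup.mk (rels n) (Tf n)

/-- The half-twist `σ_i` in `EM n`. -/
def σ (n : ℕ) (i : ℕ) : EM n := PresentedGroup.mk (rels n) (σf n i)

/-- `α₀ = σ₁ ⋯ σ_{n-1}` in `EM n`. -/
def α₀ (n : ℕ) : EM n := PresentedGroup.mk (rels n) (σfProd n 1 (n - 1))

/-- `α₂ = σ₁ ⋯ σ_{n-3} σ_{n-2}²` in `EM n`. -/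
def α₂ (n : ℕ) : EM n := PresentedGroup.mk (rels n) (σfProd n 1 (n - 2) * σf n (n - 2))

end SphereEMCG

namespace SphereEMCG

section AlternatingBraid

variable {G : Type*} [Group G]

theorem braid_conj {a b : G} (h : a * b * a = b * a * b) : a * b * a⁻¹ = b⁻¹ * a * b := by
  rw [mul_inv_eq_iff_eq_mul, mul_assoc, mul_assoc, eq_inv_mul_iff_mul_eq, ← mul_assoc,
    ← mul_assoc, h]

theorem braid_inv {a b : G} (h : a * b * a = b * a * b) :
    a⁻¹ * b⁻¹ * a⁻¹ = b⁻¹ * a⁻¹ * b⁻¹ := by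
  simpa [mul_assoc] using congrArg (·⁻¹) h

theorem braid_conj_inv {a b : G} (h : a * b * a = b * a * b) :
    a * b⁻¹ * a⁻¹ = b⁻¹ * a⁻¹ * b := by
  simpa [mul_assoc] using congrArg (·⁻¹) (braid_conj h)

/-- A sequence such that the elements `(u k)^((-1)^k)` satisfy the braid relations, with far
commutativity required only for indices at distance at most `n - 2`. -/
structure IsAlternatingBraid (n : ℤ) (u : ℤ → G) : Prop where
  braid : ∀ k, u k * (u (k + 1))⁻¹ * u k = (u (k + 1))⁻¹ * u k * (u (k + 1))⁻¹
  comm : ∀ i j, i + 2 ≤ j → j ≤ i + n - 2 → Commute (u i) (u j)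

/-- The quotient of the two given generators, and its shifts. -/
def shiftedQuotient (u : ℤ → G) (k : ℤ) : G :=
  u k * (u (k + 2))⁻¹ * u (k + 3) * u (k + 2) * (u (k + 1))⁻¹

theorem quotient_eq_conj {a b c d : G} (had : Commute a d) (hbd : Commute b d)
    (hcd : c * d * c = d * c * d) :
    a * c⁻¹ * d⁻¹ * c * b = d * (a * c⁻¹ * b) * d⁻¹ := by
  have h : c⁻¹ * d⁻¹ * c = d * c⁻¹ * d⁻¹ := (braid_conj_inv hcd.symm).symm
  calc a * c⁻¹ * d⁻¹ * c * b = a * (c⁻¹ * d⁻¹ * c) * b := by group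
    _ = (a * d) * c⁻¹ * (d⁻¹ * b) := by rw [h]; group
    _ = (d * a) * c⁻¹ * (b * d⁻¹) := by rw [had.eq, hbd.inv_right.eq]
    _ = _ := by group

theorem quotient_mul_shift {d e f g h : G} (hfg : f * g * f = g * f * g)
    (hdg : Commute d g) (hdh : Commute d h) (hfh : Commute f h) :
    (d⁻¹ * f * g * f⁻¹ * e⁻¹) * (e * g⁻¹ * h⁻¹ * g * f) = g⁻¹ * h⁻¹ * (d⁻¹ * (f * g * f)) := by
  calc (d⁻¹ * f * g * f⁻¹ * e⁻¹) * (e * g⁻¹ * h⁻¹ * g * f)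
      = d⁻¹ * (f * g * f⁻¹) * g⁻¹ * h⁻¹ * g * f := by group
    _ = (d⁻¹ * g⁻¹) * (f * h⁻¹) * g * f := by rw [braid_conj hfg]; group
    _ = g⁻¹ * (d⁻¹ * h⁻¹) * f * g * f := by
      rw [hdg.inv_inv.eq, hfh.inv_right.eq]; group
    _ = _ := by rw [hdh.inv_inv.eq]; group

theorem quotient_shift_conj {d e f g h : G} (hfg : f * g * f = g * f * g)
    (hdg : Commute d g) (hdh : Commute d h) (hfh : Commute f h)
    (heg : Commute e g) (heh : Commute e h) :
    (e * g⁻¹ * h⁻¹ * g * f)⁻¹ * (d⁻¹ * f * g * f⁻¹ * e⁻¹) * (e * g⁻¹ * h⁻¹ * g * f) =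
      f⁻¹ * g⁻¹ * e⁻¹ * d⁻¹ * (f * g * f) := by
  rw [mul_assoc, quotient_mul_shift hfg hdg hdh hfh]
  calc (e * g⁻¹ * h⁻¹ * g * f)⁻¹ * (g⁻¹ * h⁻¹ * (d⁻¹ * (f * g * f)))
      = f⁻¹ * g⁻¹ * h * (g * e⁻¹) * g⁻¹ * h⁻¹ * (d⁻¹ * (f * g * f)) := by group
    _ = f⁻¹ * g⁻¹ * (h * e⁻¹) * h⁻¹ * (d⁻¹ * (f * g * f)) := by
      rw [heg.symm.inv_right.eq]; group
    _ = _ := by rw [heh.symm.inv_right.eq]; group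

theorem mul_commutator_eq {a b c q w : G} (hbc : b * c * b = c * b * c) (hqb : Commute q b)
    (hqc : Commute q c) (hac : Commute a c) (hw : Commute w (q * b * a⁻¹)) :
    (a * c⁻¹ * b) * ((c * w) * (q * b * a⁻¹) * (c * w)⁻¹) * (q * b * a⁻¹)⁻¹ = a := by
  calc _ = a * c⁻¹ * b * c * (w * (q * b * a⁻¹)) * w⁻¹ * c⁻¹ * a * b⁻¹ * q⁻¹ := by group
    _ = a * c⁻¹ * b * (c * q) * b * (a⁻¹ * c⁻¹) * a * b⁻¹ * q⁻¹ := by rw [hw.eq]; group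
    _ = a * c⁻¹ * (b * q) * (c * b * c⁻¹) * b⁻¹ * q⁻¹ := by
      rw [hac.inv_inv.eq, hqc.symm.eq]; group
    _ = a * c⁻¹ * (q * c) * q⁻¹ := by rw [hqb.symm.eq, braid_conj hbc.symm]; group
    _ = a := by rw [hqc.eq]; group

theorem quotient_product_eq_descending {a b c d e f : G} (hcd : c * d * c = d * c * d)
    (hde : d * e * d = e * d * e) (hbe : Commute b e) (hbf : Commute b f) (hdf : Commute d f)
    (hce : Commute c e) (hcf : Commute c f) (hrot : b * c * d * e * f = c * d * e * f * a) :
    (c * e⁻¹ * f⁻¹ * e * d)⁻¹ * (b⁻¹ * d * e * d⁻¹ * c⁻¹)⁻¹ * (c * e⁻¹ * f⁻¹ * e * d) *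
      (d⁻¹ * f * a * f⁻¹ * e⁻¹)⁻¹ * (b⁻¹ * d * e * d⁻¹ * c⁻¹)⁻¹ = d * c * b := by
  have ha : f * a * f⁻¹ = e⁻¹ * d⁻¹ * c⁻¹ * b * c * d * e := by
    rw [← inv_mul_eq_iff_eq_mul] at hrot
    rw [← hrot]
    group
  have hl : (c * e⁻¹ * f⁻¹ * e * d)⁻¹ * (b⁻¹ * d * e * d⁻¹ * c⁻¹)⁻¹ *
      (c * e⁻¹ * f⁻¹ * e * d) = e⁻¹ * d⁻¹ * b * c * d := by
    rw [← mul_inv_rev, quotient_mul_shift hde hbe hbf hdf]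
    calc _ = (d⁻¹ * e⁻¹ * d⁻¹) * b * f * (e * c) * e⁻¹ * f⁻¹ * e * d := by group
      _ = (d⁻¹ * e⁻¹ * d⁻¹) * b * (f * c) * f⁻¹ * e * d := by rw [hce.symm.eq]; group
      _ = e⁻¹ * d⁻¹ * (e⁻¹ * b) * (c * e) * d := by
        rw [hcf.symm.eq, braid_inv hde]; group
      _ = e⁻¹ * d⁻¹ * b * (e⁻¹ * e) * c * d := by
        rw [hbe.symm.inv_left.eq, hce.eq]; group
      _ = _ := by group
  rw [hl, mul_inv_eq_iff_eq_mul, mul_inv_eq_iff_eq_mul]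
  symm
  calc _ = (d * c * d) * e * (d⁻¹ * c⁻¹ * d⁻¹) * (f * a * f⁻¹) * e⁻¹ := by group
    _ = c * d * (c * e) * c⁻¹ * d⁻¹ * (c⁻¹ * e⁻¹) * d⁻¹ * c⁻¹ * b * c * d := by
      rw [ha, ← hcd, ← braid_inv hcd]; group
    _ = c * d * e * d⁻¹ * e⁻¹ * (c⁻¹ * d⁻¹ * c⁻¹) * b * c * d := by
      rw [hce.eq, hce.inv_inv.eq]; group
    _ = c * d * e * (d⁻¹ * e⁻¹ * d⁻¹) * c⁻¹ * d⁻¹ * b * c * d := by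
      rw [braid_inv hcd]; group
    _ = c * e⁻¹ * c⁻¹ * d⁻¹ * b * c * d := by rw [braid_inv hde]; group
    _ = _ := by rw [hce.inv_right.eq]; group

theorem ascending_mul_quotient_inv_eq {a b c d : G} (hbc : b * c * b = c * b * c)
    (hcd : c * d * c = d * c * d) (hbd : Commute b d) (had : Commute a d) :
    (a * b * c) * (b⁻¹ * c⁻¹ * d⁻¹) * (a * c⁻¹ * d⁻¹ * c * b)⁻¹ = d⁻¹ := by
  calc _ = a * (b * c * b⁻¹) * c⁻¹ * (d⁻¹ * b⁻¹) * c⁻¹ * d * c * a⁻¹ := by group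
    _ = a * (c⁻¹ * d⁻¹ * c⁻¹) * d * c * a⁻¹ := by
      rw [braid_conj hbc, hbd.symm.inv_inv.eq]; group
    _ = (a * d⁻¹) * a⁻¹ := by rw [braid_inv hcd]; group
    _ = _ := by rw [had.inv_right.eq]; group

namespace IsAlternatingBraid

variable {n : ℤ} {u : ℤ → G}

theorem conj_quotient (hu : IsAlternatingBraid n u) (hn : 8 ≤ n) :
    ((shiftedQuotient u 4)⁻¹ * shiftedQuotient u 3 * shiftedQuotient u 4) *
      shiftedQuotient u 0 *
        ((shiftedQuotient u 4)⁻¹ * shiftedQuotient u 3 * shiftedQuotient u 4)⁻¹ =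
      u 0 * (u 2)⁻¹ * (u 1)⁻¹ := by
  have c (i j : ℤ) (h : i + 2 ≤ j := by omega) (h' : j ≤ i + 6 := by omega) :
      Commute (u i) (u j) := hu.comm i j h (by omega)
  have h₀ : shiftedQuotient u 0 = (u 3)⁻¹ * (u 0 * (u 2)⁻¹ * (u 1)⁻¹) * (u 3)⁻¹⁻¹ := by
    rw [← quotient_eq_conj (c 0 3).inv_right (c 1 3).inv_inv (hu.braid 2)]
    simp [shiftedQuotient]
  have hP : (shiftedQuotient u 4)⁻¹ * shiftedQuotient u 3 * shiftedQuotient u 4 =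
      u 5 * (u 6)⁻¹ * (u 4)⁻¹ * u 3 * ((u 5)⁻¹ * u 6 * (u 5)⁻¹) := by
    have hb : (u 5)⁻¹ * u 6 * (u 5)⁻¹ = u 6 * (u 5)⁻¹ * u 6 := by
      simpa using braid_inv (hu.braid 5)
    have := quotient_shift_conj (e := u 4) hb (c 3 6).inv_left
      (c 3 7).inv_inv (c 5 7).inv_inv (c 4 6) (c 4 7).inv_right
    simpa [shiftedQuotient] using this
  have hM : Commute ((u 5)⁻¹ * u 6 * (u 5)⁻¹) (shiftedQuotient u 0) := by
    have (i : ℤ) (h : i ≤ 3 := by omega) (h' : 0 ≤ i := by omega) :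
        Commute ((u 5)⁻¹ * u 6 * (u 5)⁻¹) (u i) :=
      (((c i 5).inv_right.mul_right (c i 6)).mul_right (c i 5).inv_right).symm
    exact ((((this 0).mul_right (this 2).inv_right).mul_right (this 3)).mul_right
      (this 2)).mul_right (this 1).inv_right
  have hF : Commute (u 5 * (u 6)⁻¹ * (u 4)⁻¹) (u 0 * (u 2)⁻¹ * (u 1)⁻¹) := by
    have (i : ℤ) (h : i ≤ 2 := by omega) (h' : 0 ≤ i := by omega) :
        Commute (u 5 * (u 6)⁻¹ * (u 4)⁻¹) (u i) :=
      (((c i 5).mul_right (c i 6).inv_right).mul_right (c i 4).inv_right).symm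
    exact ((this 0).mul_right (this 2).inv_right).mul_right (this 1).inv_right
  rw [hP, mul_inv_eq_iff_eq_mul, mul_assoc _ _ (shiftedQuotient u 0), hM.eq, h₀]
  calc _ = (u 5 * (u 6)⁻¹ * (u 4)⁻¹) * (u 0 * (u 2)⁻¹ * (u 1)⁻¹) * u 3 *
        ((u 5)⁻¹ * u 6 * (u 5)⁻¹) := by group
    _ = _ := by rw [hF.eq]; group

/-- The generator `u 0` in terms of shifts of `u 0 * (u 2)⁻¹ * (u 1)⁻¹`. -/
theorem eq_mul_commutator (hu : IsAlternatingBraid n u) (hn : 8 ≤ n) :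
    u 0 = (u 0 * (u 2)⁻¹ * (u 1)⁻¹) *
      ((u 2 * (u 4)⁻¹ * (u 3)⁻¹) * (u (-1) * (u 1)⁻¹ * (u 0)⁻¹) *
        (u 2 * (u 4)⁻¹ * (u 3)⁻¹)⁻¹) * (u (-1) * (u 1)⁻¹ * (u 0)⁻¹)⁻¹ := by
  have c (i j : ℤ) (h : i + 2 ≤ j := by omega) (h' : j ≤ i + 6 := by omega) :
      Commute (u i) (u j) := hu.comm i j h (by omega)
  have h₁ : Commute ((u 4)⁻¹ * (u 3)⁻¹) (u (-1) * (u 1)⁻¹ * (u 0)⁻¹) := by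
    have (i : ℤ) (h : i ≤ 1 := by omega) (h' : -1 ≤ i := by omega) :
        Commute ((u 4)⁻¹ * (u 3)⁻¹) (u i) :=
      ((c i 4).inv_right.mul_right (c i 3).inv_right).symm
    exact ((this (-1)).mul_right (this 1).inv_right).mul_right (this 0).inv_right
  have h₂ : (u 1)⁻¹ * u 2 * (u 1)⁻¹ = u 2 * (u 1)⁻¹ * u 2 := by
    simpa using braid_inv (hu.braid 1)
  have := mul_commutator_eq h₂ (c (-1) 1).inv_right (c (-1) 2) (c 0 2) h₁
  simpa only [mul_assoc] using this.symm

theorem descending_eq (hu : IsAlternatingBraid n u) (hn : 6 ≤ n)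
    (hrot : (u 1)⁻¹ * u 2 * (u 3)⁻¹ * u 4 * (u 5)⁻¹ = u 2 * (u 3)⁻¹ * u 4 * (u 5)⁻¹ * u 6) :
    (shiftedQuotient u 2)⁻¹ * (shiftedQuotient u 1)⁻¹ * shiftedQuotient u 2 *
      (shiftedQuotient u 3)⁻¹ * (shiftedQuotient u 1)⁻¹ = (u 3)⁻¹ * u 2 * (u 1)⁻¹ := by
  have c (i j : ℤ) (h : i + 2 ≤ j := by omega) (h' : j ≤ i + 4 := by omega) :
      Commute (u i) (u j) := hu.comm i j h (by omega)
  have h₃ : (u 3)⁻¹ * u 4 * (u 3)⁻¹ = u 4 * (u 3)⁻¹ * u 4 := by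
    simpa using braid_inv (hu.braid 3)
  have := quotient_product_eq_descending (hu.braid 2) h₃ (c 1 4).inv_left (c 1 5).inv_inv
    (c 3 5).inv_inv (c 2 4) (c 2 5).inv_right hrot
  simpa [shiftedQuotient] using this

theorem ascending_mul_eq (hu : IsAlternatingBraid n u) (hn : 6 ≤ n) :
    (u 0 * (u 1)⁻¹ * u 2) * (u 1 * (u 2)⁻¹ * u 3) * (shiftedQuotient u 0)⁻¹ = u 3 := by
  have c (i j : ℤ) (h : i + 2 ≤ j := by omega) (h' : j ≤ i + 4 := by omega) :
      Commute (u i) (u j) := hu.comm i j h (by omega)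
  have h₁ : (u 1)⁻¹ * u 2 * (u 1)⁻¹ = u 2 * (u 1)⁻¹ * u 2 := by
    simpa using braid_inv (hu.braid 1)
  have := ascending_mul_quotient_inv_eq h₁ (hu.braid 2) (c 1 3).inv_inv (c 0 3).inv_right
  simpa [shiftedQuotient] using this

section Subgroup

variable {A : G} {H : Subgroup G}

/-- If `A` shifts `u`, then a subgroup containing `A` and the quotient contains all of `u`. -/
theorem generator_mem (hu : IsAlternatingBraid n u) (hA : ∀ k, A * u k * A⁻¹ = u (k + 1))
    (hn : 6 ≤ n)
    (hrot : 8 ≤ n ∨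
      (u 1)⁻¹ * u 2 * (u 3)⁻¹ * u 4 * (u 5)⁻¹ = u 2 * (u 3)⁻¹ * u 4 * (u 5)⁻¹ * u 6)
    (hAH : A ∈ H) (hX : shiftedQuotient u 0 ∈ H) (k : ℤ) : u k ∈ H := by
  have hconj (x : G) : A * x * A⁻¹ ∈ H ↔ x ∈ H := by
    rw [Subgroup.mul_mem_cancel_right _ (inv_mem hAH), Subgroup.mul_mem_cancel_left _ hAH]
  have hz (f : ℤ → G) (hf : ∀ k, A * f k * A⁻¹ = f (k + 1)) (i j : ℤ) (hi : f i ∈ H) :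
      f j ∈ H := by
    have step (k : ℤ) : f (k + 1) ∈ H ↔ f k ∈ H := by rw [← hf, hconj]
    have (k : ℤ) : f k ∈ H ↔ f 0 ∈ H := by
      induction k with
      | zero => rfl
      | succ k ih => rw [step, ih]
      | pred k ih => rw [← ih, ← step, sub_add_cancel]
    rw [this] at hi ⊢
    exact hi
  have hAi (k : ℤ) : A * (u k)⁻¹ * A⁻¹ = (u (k + 1))⁻¹ := by rw [← hA]; group
  have hX (k : ℤ) : shiftedQuotient u k ∈ H := by
    refine hz _ (fun k ↦ ?_) 0 k hX
    calc _ = (A * u k * A⁻¹) * (A * (u (k + 2))⁻¹ * A⁻¹) * (A * u (k + 3) * A⁻¹) *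
          (A * u (k + 2) * A⁻¹) * (A * (u (k + 1))⁻¹ * A⁻¹) := by
          simp only [shiftedQuotient]; group
      _ = _ := by simp only [hA, hAi, shiftedQuotient, add_right_comm _ _ (1 : ℤ)]
  obtain hn' | hrot := hrot
  · have hZ (k : ℤ) : u k * (u (k + 2))⁻¹ * (u (k + 1))⁻¹ ∈ H := by
      refine hz (fun k ↦ u k * (u (k + 2))⁻¹ * (u (k + 1))⁻¹) (fun k ↦ ?_) 0 k ?_
      · calc _ = (A * u k * A⁻¹) * (A * (u (k + 2))⁻¹ * A⁻¹) *
              (A * (u (k + 1))⁻¹ * A⁻¹) := by group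
          _ = _ := by simp only [hA, hAi, add_right_comm _ _ (1 : ℤ)]
      · have := hu.conj_quotient hn'
        simp only [zero_add]
        rw [← this]
        have hP := mul_mem (mul_mem (inv_mem (hX 4)) (hX 3)) (hX 4)
        exact mul_mem (mul_mem hP (hX 0)) (inv_mem hP)
    refine hz u hA 0 k ?_
    rw [hu.eq_mul_commutator hn']
    have h₀ := hZ 0
    have h₂ := hZ 2
    have h₁ := hZ (-1)
    norm_num at h₀ h₁ h₂
    exact mul_mem (mul_mem h₀ (mul_mem (mul_mem h₂ h₁) (inv_mem h₂))) (inv_mem h₁)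
  · have hV (k : ℤ) : u k * (u (k + 1))⁻¹ * u (k + 2) ∈ H := by
      refine hz (fun k ↦ u k * (u (k + 1))⁻¹ * u (k + 2)) (fun k ↦ ?_) 1 k ?_
      · calc _ = (A * u k * A⁻¹) * (A * (u (k + 1))⁻¹ * A⁻¹) *
              (A * u (k + 2) * A⁻¹) := by group
          _ = _ := by simp only [hA, hAi, add_right_comm _ _ (1 : ℤ)]
      · have := hu.descending_eq hn hrot
        norm_num
        rw [← inv_mem_iff]
        have h : (u 1 * (u 2)⁻¹ * u 3)⁻¹ = (u 3)⁻¹ * u 2 * (u 1)⁻¹ := by group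
        rw [h, ← this]
        exact mul_mem (mul_mem (mul_mem (mul_mem (inv_mem (hX 2)) (inv_mem (hX 1))) (hX 2))
          (inv_mem (hX 3))) (inv_mem (hX 1))
    refine hz u hA 3 k ?_
    rw [← hu.ascending_mul_eq hn]
    have h₀ := hV 0
    have h₁ := hV 1
    norm_num at h₀ h₁
    exact mul_mem (mul_mem h₀ h₁) (inv_mem (hX 0))

end Subgroup

end IsAlternatingBraid

end AlternatingBraid

section Presentation

variable {n : ℕ}

theorem mk_eq_one {r : FreeGroup (Gen n)} (hr : r ∈ rels n) : PresentedGroup.mk (rels n) r = 1 :=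
  PresentedGroup.one_of_mem hr

theorem T_mul_T : T n * T n = 1 :=
  mk_eq_one (.inl rfl)

theorem T_inv : (T n)⁻¹ = T n :=
  inv_eq_of_mul_eq_one_left T_mul_T

theorem T_conj_σ {i : ℕ} (h : 1 ≤ i) (h' : i ≤ n - 1) : T n * σ n i * (T n)⁻¹ = (σ n i)⁻¹ := by
  have : T n * σ n i * (T n * σ n i) = 1 := mk_eq_one (.inr (.inl ⟨i, h, h', rfl⟩))
  rw [T_inv, eq_inv_iff_mul_eq_one, ← this]
  group

theorem σ_commute {i j : ℕ} (hi : 1 ≤ i) (hij : i + 2 ≤ j) (hj : j ≤ n - 1) :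
    Commute (σ n i) (σ n j) := by
  have := mk_eq_one (n := n) (.inr (.inr (.inl
    ⟨i, j, hi, by omega, by omega, hj, .inl hij, rfl⟩)))
  rw [map_mul, map_inv, mul_inv_eq_one] at this
  exact this

theorem σ_braid {i : ℕ} (hi : 1 ≤ i) (hi' : i + 1 ≤ n - 1) :
    σ n i * σ n (i + 1) * σ n i = σ n (i + 1) * σ n i * σ n (i + 1) := by
  have := mk_eq_one (n := n) (.inr (.inr (.inr (.inl
    ⟨i, i + 1, hi, by omega, by omega, hi', .inl rfl, rfl⟩))))
  rw [map_mul, map_inv, mul_inv_eq_one] at this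
  exact this

theorem mk_list_prod (l : List ℕ) :
    PresentedGroup.mk (rels n) (l.map (σf n)).prod = (l.map (σ n)).prod := by
  rw [map_list_prod, List.map_map]
  rfl

theorem α₀_eq : α₀ n = ((List.range' 1 (n - 1)).map (σ n)).prod :=
  mk_list_prod _

theorem α₀_mul_reverse : α₀ n * ((List.range' 1 (n - 1)).reverse.map (σ n)).prod = 1 := by
  have := mk_eq_one (n := n) (.inr (.inr (.inr (.inr (.inl rfl)))))
  rwa [map_mul, σfProdRev, mk_list_prod] at this

theorem α₂_eq (hn : 2 ≤ n) : α₂ n = α₀ n * (σ n (n - 1))⁻¹ * σ n (n - 2) := by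
  have h : α₀ n = PresentedGroup.mk (rels n) (σfProd n 1 (n - 2)) * σ n (n - 1) := by
    obtain ⟨m, rfl⟩ := Nat.exists_eq_add_of_le' hn
    rw [α₀_eq, σfProd, mk_list_prod]
    simp [List.range'_concat, add_comm]
  rw [h, mul_inv_cancel_right]
  exact map_mul ..

theorem T_commute_α₀ : Commute (T n) (α₀ n) := by
  have key (l : List ℕ) (hl : ∀ i ∈ l, 1 ≤ i ∧ i ≤ n - 1) :
      T n * (l.map (σ n)).prod * (T n)⁻¹ = ((l.reverse.map (σ n)).prod)⁻¹ := by
    induction l with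
    | nil => simp
    | cons i l ih =>
      rw [List.forall_mem_cons] at hl
      simp only [List.map_cons, List.prod_cons, List.reverse_cons, List.map_append,
        List.prod_append, List.map_nil, List.prod_nil, mul_one, mul_inv_rev, ← ih hl.2,
        ← T_conj_σ hl.1.1 hl.1.2]
      group
  have := key (List.range' 1 (n - 1)) (fun i hi ↦ by rw [List.mem_range'_1] at hi; omega)
  rw [← α₀_eq, ← eq_inv_of_mul_eq_one_left α₀_mul_reverse] at this
  exact mul_inv_eq_iff_eq_mul.mp this

theorem α₀_mul_σ {i : ℕ} (hi : 1 ≤ i) (hi' : i + 1 ≤ n - 1) :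
    α₀ n * σ n i = σ n (i + 1) * α₀ n := by
  have hcomm (x : EM n) (l : List ℕ) (hl : ∀ j ∈ l, Commute x (σ n j)) :
      Commute x (l.map (σ n)).prod :=
    Commute.list_prod_right _ _ (by simpa using hl)
  have hsplit : List.range' 1 (n - 1) =
      List.range' 1 (i - 1) ++ i :: (i + 1) :: List.range' (i + 2) (n - 2 - i) := by
    have h₁ : n - 1 = (i - 1) + (n - 2 - i + 1 + 1) := by omega
    rw [h₁, ← List.range'_append_1, List.range'_succ, List.range'_succ, Nat.add_sub_cancel' hi]
  have hP := hcomm (σ n (i + 1)) (List.range' 1 (i - 1)) fun j hj ↦ by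
    rw [List.mem_range'_1] at hj
    exact (σ_commute (by omega) (by omega) (by omega)).symm
  have hQ := hcomm (σ n i) (List.range' (i + 2) (n - 2 - i)) fun j hj ↦ by
    rw [List.mem_range'_1] at hj
    exact σ_commute hi (by omega) (by omega)
  rw [α₀_eq, hsplit, List.map_append, List.prod_append, List.map_cons, List.map_cons,
    List.prod_cons, List.prod_cons]
  generalize ((List.range' 1 (i - 1)).map (σ n)).prod = P at *
  generalize ((List.range' (i + 2) (n - 2 - i)).map (σ n)).prod = Q at *
  calc _ = P * σ n i * σ n (i + 1) * (Q * σ n i) := by group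
    _ = P * (σ n i * σ n (i + 1) * σ n i) * Q := by rw [← hQ.eq]; group
    _ = (P * σ n (i + 1)) * σ n i * σ n (i + 1) * Q := by rw [σ_braid hi hi']; group
    _ = _ := by rw [← hP.eq]; group

/-- The conjugates of `(σ 1)⁻¹` by the powers of `T * α₀`. -/
def orbit (n : ℕ) (k : ℤ) : EM n :=
  MulAut.conj ((T n * α₀ n) ^ (k - 1)) (σ n 1)⁻¹

theorem conj_orbit (m k : ℤ) :
    MulAut.conj ((T n * α₀ n) ^ m) (orbit n k) = orbit n (k + m) := by
  rw [orbit, orbit, ← MulAut.mul_apply, ← map_mul, ← zpow_add, add_sub_assoc', add_comm m]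

theorem conj_orbit_one (k : ℤ) :
    (T n * α₀ n) * orbit n k * (T n * α₀ n)⁻¹ = orbit n (k + 1) := by
  simpa [mul_assoc] using conj_orbit (n := n) 1 k

theorem T_conj_orbit (hn : 2 ≤ n) (k : ℤ) : MulAut.conj (T n) (orbit n k) = (orbit n k)⁻¹ := by
  have h : Commute (T n) ((T n * α₀ n) ^ (k - 1)) :=
    ((Commute.refl _).mul_right T_commute_α₀).zpow_right _
  have hσ : MulAut.conj (T n) (σ n 1) = (σ n 1)⁻¹ := T_conj_σ le_rfl (by omega)
  rw [orbit, ← MulAut.mul_apply, ← map_mul, h.eq, map_mul, MulAut.mul_apply, map_inv, hσ, map_inv]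

theorem orbit_natCast {k : ℕ} (hk : 1 ≤ k) (hk' : k ≤ n - 1) :
    orbit n k = if Even k then σ n k else (σ n k)⁻¹ := by
  induction k, hk using Nat.le_induction with
  | base => simp [orbit]
  | succ k hk ih =>
    have h : T n * α₀ n * σ n k * (T n * α₀ n)⁻¹ = (σ n (k + 1))⁻¹ := by
      rw [← T_conj_σ (by omega) hk', mul_assoc (T n), α₀_mul_σ hk hk']
      group
    have h' : T n * α₀ n * (σ n k)⁻¹ * (T n * α₀ n)⁻¹ = σ n (k + 1) := by
      rw [← inv_inv (σ n (k + 1)), ← h]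
      group
    push_cast
    rw [← conj_orbit_one, ih (by omega)]
    by_cases hk : Even k <;> simp [hk, Nat.even_add_one, h, h', -mul_inv_rev]

theorem orbit_mem_iff {H : Subgroup (EM n)} {k : ℕ} (hk : 1 ≤ k) (hk' : k ≤ n - 1) :
    orbit n k ∈ H ↔ σ n k ∈ H := by
  rw [orbit_natCast hk hk']
  split_ifs <;> simp

theorem orbit_isAlternatingBraid (hn : 3 ≤ n) : IsAlternatingBraid n (orbit n) where
  braid k := by
    have h₁ : orbit n 1 = (σ n 1)⁻¹ := by simpa using orbit_natCast (n := n) le_rfl (by omega)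
    have h₂ : orbit n 2 = σ n 2 := by
      simpa using orbit_natCast (n := n) (k := 2) (by omega) (by omega)
    have h : orbit n 1 * (orbit n 2)⁻¹ * orbit n 1 =
        (orbit n 2)⁻¹ * orbit n 1 * (orbit n 2)⁻¹ := by
      rw [h₁, h₂]
      exact braid_inv (σ_braid le_rfl (by omega))
    have := congrArg (MulAut.conj ((T n * α₀ n) ^ (k - 1))) h
    simpa only [map_mul, map_inv, conj_orbit, add_sub_cancel, show 2 + (k - 1) = k + 1 by ring]
      using this
  comm i j hij hji := by
    obtain ⟨m, hm⟩ := Int.eq_ofNat_of_zero_le (show 0 ≤ j - i + 1 by omega)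
    have h : Commute (orbit n (1 : ℕ)) (orbit n m) := by
      have := σ_commute (n := n) (i := 1) (j := m) le_rfl (by omega) (by omega)
      rw [orbit_natCast le_rfl (by omega), orbit_natCast (by omega) (by omega)]
      split_ifs <;> simp [this]
    have := h.map (MulAut.conj ((T n * α₀ n) ^ (i - 1)))
    simp only [conj_orbit, ← hm] at this
    convert this using 2 <;> push_cast <;> ring

theorem orbit_six_rotation :
    (orbit 6 3)⁻¹ * orbit 6 4 * (orbit 6 5)⁻¹ * orbit 6 6 * (orbit 6 7)⁻¹ =
      orbit 6 4 * (orbit 6 5)⁻¹ * orbit 6 6 * (orbit 6 7)⁻¹ * orbit 6 8 := by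
  have hα : α₀ 6 = (orbit 6 1)⁻¹ * orbit 6 2 * (orbit 6 3)⁻¹ * orbit 6 4 * (orbit 6 5)⁻¹ := by
    have h₁ := orbit_natCast (n := 6) (k := 1) (by omega) (by omega)
    have h₂ := orbit_natCast (n := 6) (k := 2) (by omega) (by omega)
    have h₃ := orbit_natCast (n := 6) (k := 3) (by omega) (by omega)
    have h₄ := orbit_natCast (n := 6) (k := 4) (by omega) (by omega)
    have h₅ := orbit_natCast (n := 6) (k := 5) (by omega) (by omega)
    have e₃ : ¬ Even 3 := by decide
    have e₄ : Even 4 := by decide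
    have e₅ : ¬ Even 5 := by decide
    simp [e₃, e₄, e₅] at h₁ h₂ h₃ h₄ h₅
    rw [h₁, h₂, h₃, h₄, h₅, α₀_eq]
    simp [List.range', mul_assoc]
  have hconj (m : ℤ) : MulAut.conj ((T 6 * α₀ 6) ^ m) (α₀ 6) = α₀ 6 := by
    rw [MulAut.conj_apply, mul_inv_eq_iff_eq_mul]
    exact (((T_commute_α₀ (n := 6)).mul_left (Commute.refl _)).zpow_left m).eq
  have hT : MulAut.conj (T 6) (α₀ 6) = α₀ 6 := by
    rw [MulAut.conj_apply, mul_inv_eq_iff_eq_mul]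
    exact T_commute_α₀.eq
  have h₂ := congrArg (MulAut.conj ((T 6 * α₀ 6) ^ (2 : ℤ))) hα
  have h₃ := congrArg (MulAut.conj (T 6)) (congrArg (MulAut.conj ((T 6 * α₀ 6) ^ (3 : ℤ))) hα)
  rw [hconj] at h₂ h₃
  rw [hT] at h₃
  simp only [map_mul, map_inv, conj_orbit, T_conj_orbit (n := 6) (by norm_num), inv_inv,
    Int.reduceAdd] at h₂ h₃
  rw [← h₂, ← h₃]

theorem eq_top_of_mem {H : Subgroup (EM n)} (hT : T n ∈ H)
    (hσ : ∀ i, 1 ≤ i → i ≤ n - 1 → σ n i ∈ H) : H = ⊤ := by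
  rw [← top_le_iff, ← PresentedGroup.closure_range_of, Subgroup.closure_le]
  rintro _ ⟨_ | i, rfl⟩
  · exact hT
  · have := hσ (i + 1) (by omega) (by omega)
    rwa [σ, σf, dif_pos (by omega)] at this

theorem α₀_mem {H : Subgroup (EM n)} (hσ : ∀ i, 1 ≤ i → i ≤ n - 1 → σ n i ∈ H) : α₀ n ∈ H := by
  rw [α₀_eq]
  refine Subgroup.list_prod_mem _ fun x hx ↦ ?_
  obtain ⟨i, hi, rfl⟩ := List.mem_map.mp hx
  rw [List.mem_range'_1] at hi
  exact hσ i hi.1 (by omega)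

/-- The second generator, conjugated by `(σ (n - 3))⁻¹`, in terms of the first one. -/
theorem conj_second_generator (hn : 6 ≤ n) (heven : Even n) :
    (σ n (n - 3))⁻¹ * (T n * (σ n (n - 1))⁻¹ * α₂ n) * σ n (n - 3) =
      T n * α₀ n * shiftedQuotient (fun k ↦ orbit n (k + (n - 4 : ℕ))) 0 := by
  obtain ⟨m, rfl⟩ : ∃ m, n = m + 4 := ⟨n - 4, by omega⟩
  have hm : Even m := by simpa [Nat.even_add, show Even 4 by decide] using heven
  have h₀ := orbit_natCast (n := m + 4) (k := m) (by omega) (by omega)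
  have h₁ := orbit_natCast (n := m + 4) (k := m + 1) (by omega) (by omega)
  have h₂ := orbit_natCast (n := m + 4) (k := m + 2) (by omega) (by omega)
  have h₃ := orbit_natCast (n := m + 4) (k := m + 3) (by omega) (by omega)
  have e₃ : ¬ Even (m + 3) := by grind
  have e₂ : Even (m + 2) := by grind
  have e₁ : ¬ Even (m + 1) := by grind
  simp only [hm, e₁, e₂, e₃, if_true, if_false, Nat.cast_add, Nat.cast_one, Nat.cast_ofNat]
    at h₀ h₁ h₂ h₃
  have hA := conj_orbit_one (n := m + 4) m
  rw [h₀, h₁, mul_inv_eq_iff_eq_mul] at hA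
  have hα : (σ (m + 4) (m + 3))⁻¹ * α₀ (m + 4) = α₀ (m + 4) * (σ (m + 4) (m + 2))⁻¹ := by
    rw [inv_mul_eq_iff_eq_mul, ← mul_assoc, ← α₀_mul_σ (by omega) (by omega),
      mul_inv_cancel_right]
  rw [α₂_eq (by omega)]
  simp only [shiftedQuotient, zero_add, add_zero, Nat.add_sub_cancel, add_comm _ (m : ℤ), h₀, h₁, h₂,
    h₃, show m + 4 - 1 = m + 3 by omega, show m + 4 - 2 = m + 2 by omega,
    show m + 4 - 3 = m + 1 by omega, inv_inv]
  generalize σ (m + 4) (m + 1) = g at *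
  generalize σ (m + 4) (m + 2) = s at *
  generalize σ (m + 4) (m + 3) = t at *
  generalize σ (m + 4) m = r at *
  calc _ = g⁻¹ * T (m + 4) * (t⁻¹ * α₀ (m + 4)) * t⁻¹ * s * g := by group
    _ = g⁻¹ * (T (m + 4) * α₀ (m + 4)) * (s⁻¹ * t⁻¹ * s * g) := by rw [hα]; group
    _ = _ := by rw [← hA]; group

theorem eq_top_of_conj_generators_mem (hn : 6 ≤ n) (heven : Even n) {H : Subgroup (EM n)}
    (hA : T n * α₀ n ∈ H)
    (hB : (σ n (n - 3))⁻¹ * (T n * (σ n (n - 1))⁻¹ * α₂ n) * σ n (n - 3) ∈ H) : H = ⊤ := by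
  rw [conj_second_generator hn heven, Subgroup.mul_mem_cancel_left _ hA] at hB
  have hv := orbit_isAlternatingBraid (n := n) (by omega)
  have hu : IsAlternatingBraid n (fun k ↦ orbit n (k + (n - 4 : ℕ))) :=
    { braid k := by simpa only [add_right_comm] using hv.braid (k + (n - 4 : ℕ))
      comm i j hij hji := hv.comm _ _ (by omega) (by omega) }
  have hmem := hu.generator_mem (A := T n * α₀ n)
    (fun k ↦ by simp only [conj_orbit_one, add_right_comm]) (by omega)
    (by
      obtain rfl | h : n = 6 ∨ 8 ≤ n := by grind
      · right
        simpa using orbit_six_rotation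
      · left
        omega) hA hB
  have hσ (i : ℕ) (hi : 1 ≤ i) (hi' : i ≤ n - 1) : σ n i ∈ H := by
    rw [← orbit_mem_iff hi hi']
    simpa using hmem (i - (n - 4 : ℕ))
  exact eq_top_of_mem (by simpa using mul_mem hA (inv_mem (α₀_mem hσ))) hσ

end Presentation

end SphereEMCG

open SphereEMCG in
/-- For every even `n ≥ 6`, the extended mapping class group of the `n`-punctured
sphere is generated by `a = σ_{n-3} T α₀ σ_{n-3}⁻¹` and `b = T σ_{n-1}⁻¹ α₂`. -/
theorem em_generated_by_a_b (n : ℕ) (hn : 6 ≤ n) (heven : Even n) :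
    Subgroup.closure
      {σ n (n - 3) * T n * α₀ n * (σ n (n - 3))⁻¹,
       T n * (σ n (n - 1))⁻¹ * α₂ n} = (⊤ : Subgroup (EM n)) := by
  set K := Subgroup.closure {σ n (n - 3) * T n * α₀ n * (σ n (n - 3))⁻¹,
    T n * (σ n (n - 1))⁻¹ * α₂ n}
  have ha : σ n (n - 3) * T n * α₀ n * (σ n (n - 3))⁻¹ ∈ K :=
    Subgroup.subset_closure (by simp)
  have hb : T n * (σ n (n - 1))⁻¹ * α₂ n ∈ K := Subgroup.subset_closure (by simp)
  have htop : K.comap (MulAut.conj (σ n (n - 3))).toMonoidHom = ⊤ := by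
    refine eq_top_of_conj_generators_mem hn heven ?_ ?_
    · simpa [mul_assoc] using ha
    · simpa [mul_assoc] using hb
  rw [eq_top_iff]
  intro y _
  have hy : (σ n (n - 3))⁻¹ * y * σ n (n - 3) ∈
      K.comap (MulAut.conj (σ n (n - 3))).toMonoidHom := htop ▸ Subgroup.mem_top _
  simpa [mul_assoc] using hy
end

section
/- The group EM₄ cannot be generated by two elements of finite order: there do not exist elements a, b ∈ EM₄, each of finite order, such that the subgroup generated by {a, b} is all of EM₄. -/
namespace SphereEMCG

open Subgroup Matrix.ProjGenLinGroup
open scoped MatrixGroups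

/-- In a group generated by two involutions, any two squares commute. -/
theorem commute_sq_of_mem_closure_involutions {G : Type*} [Group G] {x y g h : G}
    (hx : x ^ 2 = 1) (hy : y ^ 2 = 1) (hg : g ∈ closure {x, y}) (hh : h ∈ closure {x, y}) :
    Commute (g ^ 2) (h ^ 2) := by
  have hxx : x * x = 1 := by rw [← pow_two, hx]
  have hyy : y * y = 1 := by rw [← pow_two, hy]
  have hxi : x⁻¹ = x := inv_eq_of_mul_eq_one_left hxx
  have hyi : y⁻¹ = y := inv_eq_of_mul_eq_one_left hyy
  have conj_mem : ∀ z ∈ zpowers (x * y), x * z * x ∈ zpowers (x * y) := by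
    rintro _ ⟨k, rfl⟩
    refine ⟨-k, ?_⟩
    have key : x * (x * y) * x⁻¹ = (x * y)⁻¹ := by
      rw [mul_inv_rev, hxi, hyi, ← mul_assoc x x y, hxx, one_mul]
    change (x * y) ^ (-k) = x * (x * y) ^ k * x
    rw [← inv_zpow', ← key, conj_zpow, hxi]
  have cover : ∀ g ∈ closure {x, y}, g ∈ zpowers (x * y) ∨ g * x ∈ zpowers (x * y) := by
    intro g hg
    induction hg using closure_induction with
    | mem g hg =>
      rcases hg with rfl | rfl
      · exact .inr (by rw [hxx]; exact one_mem _)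
      · refine .inr ⟨-1, ?_⟩
        simp [hxi, hyi]
    | one => exact .inl (one_mem _)
    | mul a b _ _ ha hb =>
      rcases ha with ha | ha <;> rcases hb with hb | hb
      · exact .inl (mul_mem ha hb)
      · exact .inr (by rw [mul_assoc]; exact mul_mem ha hb)
      · refine .inr ?_
        have := mul_mem ha (conj_mem _ hb)
        rwa [show a * x * (x * b * x) = a * (x * x) * b * x by group, hxx, mul_one] at this
      · refine .inl ?_
        have := mul_mem ha (conj_mem _ hb)
        rwa [show a * x * (x * (b * x) * x) = a * (x * x) * b * (x * x) by group, hxx, mul_one,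
          mul_one] at this
    | inv a _ ha =>
      rcases ha with ha | ha
      · exact .inl (inv_mem ha)
      · refine .inr ?_
        have := conj_mem _ (inv_mem ha)
        rwa [mul_inv_rev, hxi, ← mul_assoc, hxx, one_mul] at this
  have sq_mem : ∀ g ∈ closure {x, y}, g ^ 2 ∈ zpowers (x * y) := by
    intro g hg
    rcases cover g hg with h | h
    · exact pow_mem h 2
    · have := mul_mem h (conj_mem _ h)
      rwa [show g * x * (x * (g * x) * x) = g * (x * x) * g * (x * x) by group, hxx, mul_one,
        mul_one, ← pow_two] at this
  obtain ⟨m, hm⟩ := sq_mem g hg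
  obtain ⟨n, hn⟩ := sq_mem h hh
  simp only at hm hn
  rw [← hm, ← hn]
  exact (Commute.refl _).zpow_zpow m n

/-- The Cayley-Hamilton identity for `2 × 2` matrices. -/
theorem sq_eq_trace_smul_sub_det_smul {R : Type*} [CommRing R] (A : Matrix (Fin 2) (Fin 2) R) :
    A ^ 2 = A.trace • A - A.det • (1 : Matrix (Fin 2) (Fin 2) R) := by
  ext i j
  fin_cases i <;> fin_cases j <;>
    simp [pow_two, Matrix.mul_apply, Fin.sum_univ_two, Matrix.trace_fin_two, Matrix.det_fin_two] <;>
    ring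

theorem commute_of_pow_eq_one_of_two_le_trace {B : Matrix (Fin 2) (Fin 2) ℤ} (hdet : B.det = 1)
    (htr : 2 ≤ B.trace) {m : ℕ} (hm : 0 < m) (hB : B ^ m = 1) (C : Matrix (Fin 2) (Fin 2) ℤ) :
    Commute B C := by
  have key : ∀ k : ℕ, ∃ u v : ℤ, 0 ≤ v ∧ v < u ∧ B ^ (k + 1) = u • B - v • 1 := by
    intro k
    induction k with
    | zero => exact ⟨1, 0, by simp⟩
    | succ k ih =>
      obtain ⟨u, v, hv, huv, h⟩ := ih
      refine ⟨B.trace * u - v, u, by omega, by nlinarith, ?_⟩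
      rw [pow_succ, h, sub_mul, smul_mul_assoc, ← pow_two, sq_eq_trace_smul_sub_det_smul B, hdet,
        smul_mul_assoc, one_mul]
      module
  obtain ⟨k, rfl⟩ := Nat.exists_eq_succ_of_ne_zero hm.ne'
  obtain ⟨u, v, hv, huv, h⟩ := key k
  have hu : u • B = (1 + v) • (1 : Matrix (Fin 2) (Fin 2) ℤ) := by
    rw [← Nat.succ_eq_add_one, hB] at h
    rw [add_smul, one_smul]
    exact (eq_sub_iff_add_eq.mp h).symm
  have hc : u • (B * C) = u • (C * B) := by
    rw [← smul_mul_assoc, hu, ← mul_smul_comm, hu, smul_one_mul, mul_smul_one]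
  exact smul_right_injective _ (by omega : u ≠ 0) hc

theorem det_eq_one_or_neg_one (A : GL (Fin 2) ℤ) : A.val.det = 1 ∨ A.val.det = -1 :=
  Int.isUnit_iff.mp (A.isUnit.map Matrix.detMonoidHom)

theorem sq_mem_center_or_cube_mem_center {A : GL (Fin 2) ℤ} {m : ℕ} (hm : 0 < m) (hA : A ^ m = 1) :
    A ^ 2 ∈ center (GL (Fin 2) ℤ) ∨ A ^ 3 ∈ center (GL (Fin 2) ℤ) := by
  have mem_center_of : ∀ {k : ℕ}, (∀ C, Commute (A.val ^ k) C) → A ^ k ∈ center (GL (Fin 2) ℤ) := by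
    intro k h
    rw [mem_center_iff]
    intro g
    ext1
    simpa using (h g.val).symm.eq
  have hCH := sq_eq_trace_smul_sub_det_smul A.val
  have hd := det_eq_one_or_neg_one A
  have hdet : (A.val ^ 2).det = 1 := by
    rw [Matrix.det_pow]; rcases hd with h | h <;> simp [h]
  have htr : (A.val ^ 2).trace = A.val.trace ^ 2 - 2 * A.val.det := by
    rw [hCH, Matrix.trace_sub, Matrix.trace_smul, Matrix.trace_smul, Matrix.trace_one]; simp; ring
  by_cases h2 : 2 ≤ (A.val ^ 2).trace
  · refine .inl (mem_center_of (commute_of_pow_eq_one_of_two_le_trace hdet h2 hm ?_))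
    rw [← pow_mul, mul_comm, pow_mul, ← Units.val_pow_eq_pow_val, hA]
    simp
  · rw [htr] at h2
    generalize A.val.trace = t at *
    have hd1 : A.val.det = 1 := by
      rcases hd with h | h
      · exact h
      · nlinarith
    rw [hd1] at h2 hCH
    have ht1 : t ≤ 1 := by nlinarith
    have ht2 : -1 ≤ t := by nlinarith
    by_cases h0 : t = 0
    · left
      refine mem_center_of fun C ↦ ?_
      rw [hCH, h0]
      simp
    · right
      refine mem_center_of fun C ↦ ?_
      have ht : t * t = 1 := by
        interval_cases t <;> simp_all
      have : A.val ^ 3 = (-t) • (1 : Matrix (Fin 2) (Fin 2) ℤ) := by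
        rw [pow_succ, hCH, sub_mul, smul_mul_assoc, ← pow_two, hCH, smul_sub, smul_smul, ht,
          smul_mul_assoc, one_mul]
        module
      rw [this]
      exact (Commute.one_left C).smul_left _

theorem eq_one_or_neg_one_of_mem_center {z : GL (Fin 2) ℤ} (hz : z ∈ center (GL (Fin 2) ℤ)) :
    z = 1 ∨ z = -1 := by
  rw [Matrix.GeneralLinearGroup.center_eq_range_scalar] at hz
  obtain ⟨u, rfl⟩ := hz
  rcases Int.units_eq_one_or u with rfl | rfl
  · simp
  · right
    ext i j
    fin_cases i <;> fin_cases j <;> simp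

theorem sq_eq_one_or_cube_eq_one {x : PGL(2, ℤ)} (hx : IsOfFinOrder x) : x ^ 2 = 1 ∨ x ^ 3 = 1 := by
  obtain ⟨A, rfl⟩ := mk_surjective x
  obtain ⟨m, hm, h⟩ := isOfFinOrder_iff_pow_eq_one.mp hx
  rw [← map_pow, Matrix.ProjGenLinGroup.mk_eq_one] at h
  have h2 : A ^ (m * 2) = 1 := by
    rw [pow_mul]
    rcases eq_one_or_neg_one_of_mem_center h with h | h <;> simp [h]
  simpa only [← map_pow, Matrix.ProjGenLinGroup.mk_eq_one] using
    sq_mem_center_or_cube_mem_center (by omega) h2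

/-- The sign of the permutation of `𝔽₂²` induced by an invertible integer matrix. -/
def signModTwo : GL (Fin 2) ℤ →* ℤˣ :=
  (Equiv.Perm.sign.comp (MulAction.toPermHom (LinearMap.GeneralLinearGroup (ZMod 2) (Fin 2 → ZMod 2))
    (Fin 2 → ZMod 2))).comp <|
    Matrix.GeneralLinearGroup.toLin.toMonoidHom.comp
    (Matrix.GeneralLinearGroup.map (Int.castRingHom (ZMod 2)))

/-- The determinant and the sign of the reduction modulo two, as characters of `PGL₂(ℤ)`. -/
def character : PGL(2, ℤ) →* ℤˣ × ℤˣ :=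
  QuotientGroup.lift (center (GL (Fin 2) ℤ)) (Matrix.GeneralLinearGroup.det.prod signModTwo) (by
    intro z hz
    rcases eq_one_or_neg_one_of_mem_center hz with rfl | rfl
    · simp
    · decide)

/-- The image of `σ₁` and `σ₃` in `GL₂(ℤ)`. -/
def upper : GL (Fin 2) ℤ := ⟨!![1, 1; 0, 1], !![1, -1; 0, 1], by decide, by decide⟩

/-- The image of `σ₂` in `GL₂(ℤ)`. -/
def lower : GL (Fin 2) ℤ := ⟨!![1, 0; -1, 1], !![1, 0; 1, 1], by decide, by decide⟩

/-- The image of `T` in `GL₂(ℤ)`. -/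
def reflection : GL (Fin 2) ℤ := ⟨!![1, 0; 0, -1], !![1, 0; 0, -1], by decide, by decide⟩

/-- The images of the generators of `EM 4` in `GL₂(ℤ)`. -/
def genMatrix : Gen 4 → GL (Fin 2) ℤ
  | none => reflection
  | some i => if i.val = 1 then lower else upper

theorem lift_genMatrix_rels {r : FreeGroup (Gen 4)} (hr : r ∈ rels 4) :
    FreeGroup.lift genMatrix r = 1 ∨ FreeGroup.lift genMatrix r = -1 := by
  have h1 : FreeGroup.lift genMatrix (σf 4 1) = upper := by simp [σf, genMatrix]
  have h2 : FreeGroup.lift genMatrix (σf 4 2) = lower := by simp [σf, genMatrix]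
  have h3 : FreeGroup.lift genMatrix (σf 4 3) = upper := by simp [σf, genMatrix]
  have hT : FreeGroup.lift genMatrix (Tf 4) = reflection := by simp [Tf, genMatrix]
  rcases hr with rfl | ⟨i, hi, hi', rfl⟩ | ⟨i, j, hi, hi', hj, hj', hij, rfl⟩ |
    ⟨i, j, hi, hi', hj, hj', hij, rfl⟩ | rfl | rfl
  · simp only [map_mul, hT]; left; ext1; decide
  · left
    interval_cases i <;> simp only [map_mul, hT, h1, h2, h3] <;> ext1 <;> decide
  · left
    interval_cases i <;> interval_cases j <;> first | omega | skip
    all_goals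
      simp only [map_mul, map_inv, h1, h3]
      ext1; decide
  · left
    interval_cases i <;> interval_cases j <;> first | omega | skip
    all_goals
      simp only [map_mul, map_inv, h1, h2, h3]
      ext1; decide
  · right
    simp only [σfProd, σfProdRev, List.range', List.map, List.reverse, List.reverseAux,
      List.prod_cons, List.prod_nil, map_mul, map_one, h1, h2, h3]
    ext1; decide
  · left
    simp only [σfProd, List.range', List.map,
      List.prod_cons, List.prod_nil, map_mul, map_one, map_pow, h1, h2, h3]
    ext1; decide

/-- The projection from `EM 4` to `PGL₂(ℤ)`. -/
def toPGLTwo : EM 4 →* PGL(2, ℤ) :=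
  PresentedGroup.toGroup (f := fun x ↦ mk (genMatrix x)) (by
    intro r hr
    have : FreeGroup.lift (fun x ↦ mk (genMatrix x)) =
        mk.comp (FreeGroup.lift genMatrix) := by
      ext; simp
    rw [this]
    rcases lift_genMatrix_rels hr with h | h
    · simp [h]
    · simp [h, mem_center_iff])

theorem toPGLTwo_T : toPGLTwo (T 4) = mk reflection :=
  PresentedGroup.toGroup.of _

theorem toPGLTwo_σ_one : toPGLTwo (σ 4 1) = mk upper :=
  PresentedGroup.toGroup.of _

theorem toPGLTwo_σ_two : toPGLTwo (σ 4 2) = mk lower :=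
  PresentedGroup.toGroup.of _

theorem character_mk (A : GL (Fin 2) ℤ) :
    character (mk A) = (Matrix.GeneralLinearGroup.det A, signModTwo A) := rfl

theorem character_sq (x : PGL(2, ℤ)) : character x ^ 2 = 1 := by
  generalize character x = c
  revert c
  decide

/-- The two coordinates of `character` are independent on `upper` and `reflection`. -/
theorem character_ne_one_of_mem_closure {x y : PGL(2, ℤ)} (hu : mk upper ∈ closure {x, y})
    (hr : mk reflection ∈ closure {x, y}) : character x ≠ 1 := by
  intro hx
  have cover : ∀ g ∈ closure {x, y}, character g = 1 ∨ character g = character y := by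
    have hy := character_sq y
    intro g hg
    induction hg using closure_induction with
    | mem g hg => rcases hg with rfl | rfl <;> simp [hx]
    | one => simp
    | mul a b _ _ ha hb =>
      rw [map_mul]
      rcases ha with ha | ha <;> rcases hb with hb | hb <;> simp [ha, hb, ← pow_two, hy]
    | inv a _ ha =>
      rw [map_inv]
      rcases ha with ha | ha
      · simp [ha]
      · exact .inr (by rw [ha, inv_eq_iff_mul_eq_one, ← pow_two, hy])
  have hu' : character (mk upper) = (1, -1) := by rw [character_mk]; decide
  have hr' : character (mk reflection) = (-1, 1) := by rw [character_mk]; decide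
  have h₁ := cover _ hu
  have h₂ := cover _ hr
  rw [hu'] at h₁
  rw [hr'] at h₂
  generalize character y = c at h₁ h₂
  revert c
  decide

theorem sq_eq_one_of_mem_closure {x y : PGL(2, ℤ)} (hx : IsOfFinOrder x)
    (hu : mk upper ∈ closure {x, y}) (hr : mk reflection ∈ closure {x, y}) : x ^ 2 = 1 := by
  refine (sq_eq_one_or_cube_eq_one hx).resolve_right fun h ↦
    character_ne_one_of_mem_closure hu hr ?_
  have h3 : character x ^ 3 = 1 := by rw [← map_pow, h, map_one]
  rwa [pow_succ, character_sq, one_mul] at h3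

theorem not_commute_sq : ¬ Commute (mk upper ^ 2) (mk lower ^ 2) := by
  intro h
  rw [commute_iff_eq, ← mul_inv_eq_one] at h
  simp only [← map_pow, ← map_mul, ← map_inv, Matrix.ProjGenLinGroup.mk_eq_one] at h
  rcases eq_one_or_neg_one_of_mem_center h with h | h <;> revert h <;> decide

end SphereEMCG

open SphereEMCG in
/-- The extended mapping class group of the 4-punctured sphere cannot be generated
by two elements of finite order. -/
theorem em4_not_generated_by_two_torsion :
    ¬ ∃ a b : EM 4, IsOfFinOrder a ∧ IsOfFinOrder b ∧
      Subgroup.closure {a, b} = (⊤ : Subgroup (EM 4)) := by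
  rintro ⟨a, b, ha, hb, h⟩
  have hmem : ∀ g, toPGLTwo g ∈ Subgroup.closure {toPGLTwo a, toPGLTwo b} := by
    intro g
    rw [← Set.image_pair, ← MonoidHom.map_closure, h]
    exact Subgroup.mem_map_of_mem _ (Subgroup.mem_top g)
  have hr := hmem (T 4)
  have hu := hmem (σ 4 1)
  have hl := hmem (σ 4 2)
  rw [toPGLTwo_T] at hr
  rw [toPGLTwo_σ_one] at hu
  rw [toPGLTwo_σ_two] at hl
  refine not_commute_sq (commute_sq_of_mem_closure_involutions
    (sq_eq_one_of_mem_closure (toPGLTwo.isOfFinOrder ha) hu hr)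
    (sq_eq_one_of_mem_closure (y := toPGLTwo a) (toPGLTwo.isOfFinOrder hb) ?_ ?_) hu hl)
  · rwa [Set.pair_comm]
  · rwa [Set.pair_comm]
end

section
/- The group PGL₂(ℤ) cannot be generated by two elements of finite order: there do not exist elements x, y ∈ PGL₂(ℤ), each of finite order, such that the subgroup generated by {x, y} is all of PGL₂(ℤ). -/
/-- `GL₂(ℤ)`, the group of invertible 2×2 integer matrices. -/
abbrev GL2Z := GL (Fin 2) ℤ

/-- The subgroup `{Id, -Id}` of `GL₂(ℤ)`. -/
def negIdSubgroup : Subgroup GL2Z := Subgroup.zpowers (-1 : GL2Z)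

instance : negIdSubgroup.Normal := by
  constructor
  intro x hx g
  obtain ⟨k, rfl⟩ := Subgroup.mem_zpowers_iff.mp hx
  have h : Commute g ((-1 : GL2Z) ^ k) := (Commute.neg_one_right g).zpow_right k
  have hx' : g * (-1 : GL2Z) ^ k * g⁻¹ = (-1 : GL2Z) ^ k := by
    rw [h.eq, mul_inv_cancel_right]
  rw [hx']
  exact Subgroup.mem_zpowers_iff.mpr ⟨k, rfl⟩

/-- `PGL₂(ℤ)`, the quotient of `GL₂(ℤ)` by its center `{Id, -Id}`. -/
abbrev PGL2Z := GL2Z ⧸ negIdSubgroup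

/-- The quotient homomorphism `GL₂(ℤ) → PGL₂(ℤ)`. -/
def qPGL : GL2Z →* PGL2Z := QuotientGroup.mk' negIdSubgroup

theorem qPGL_surjective : Function.Surjective qPGL :=
  QuotientGroup.mk'_surjective negIdSubgroup

theorem qPGL_ker : qPGL.ker = negIdSubgroup :=
  QuotientGroup.ker_mk' negIdSubgroup

theorem sq_eq_one_of_mem_negIdSubgroup {C : GL2Z} (hC : C ∈ negIdSubgroup) : C ^ 2 = 1 := by
  obtain ⟨k, rfl⟩ := Subgroup.mem_zpowers_iff.mp hC
  rw [← zpow_natCast, zpow_comm]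
  simp

/-- Every lift to `GL₂(ℤ)` of a torsion element of `PGL₂(ℤ)` is torsion. -/
theorem isOfFinOrder_of_qPGL {A : GL2Z} (hA : IsOfFinOrder (qPGL A)) : IsOfFinOrder A := by
  obtain ⟨n, hn, hpow⟩ := isOfFinOrder_iff_pow_eq_one.mp hA
  refine isOfFinOrder_iff_pow_eq_one.mpr ⟨n * 2, by positivity, ?_⟩
  rw [pow_mul]
  apply sq_eq_one_of_mem_negIdSubgroup
  rw [← qPGL_ker, MonoidHom.mem_ker, map_pow, hpow]

/-- `-Id` is a square in `GL₂(ℤ)`: it is the square of the rotation by a right angle. -/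
theorem exists_sq_eq_neg_one : ∃ S : GL2Z, S ^ 2 = -1 := by
  refine ⟨⟨!![0, -1; 1, 0], !![0, 1; -1, 0], by decide, by decide⟩, Units.ext ?_⟩
  rw [Units.val_pow_eq_pow_val, Units.val_neg, Units.val_one]
  decide

/-- A subgroup of `GL₂(ℤ)` that surjects onto `PGL₂(ℤ)` is the whole group. -/
theorem eq_top_of_map_qPGL_eq_top {H : Subgroup GL2Z} (hH : H.map qPGL = ⊤) : H = ⊤ := by
  have hker : qPGL.ker ≤ H := by
    obtain ⟨S, hS⟩ := exists_sq_eq_neg_one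
    obtain ⟨h, hh, hhS⟩ : qPGL S ∈ H.map qPGL := hH ▸ Subgroup.mem_top _
    obtain ⟨k, hk⟩ : S⁻¹ * h ∈ Subgroup.zpowers (-1 : GL2Z) := by
      rw [← negIdSubgroup, ← qPGL_ker, MonoidHom.mem_ker, map_mul, map_inv, hhS, inv_mul_cancel]
    have hcomm : Commute S (S⁻¹ * h) := hk ▸ (Commute.neg_one_right S).zpow_right k
    have hsq : h ^ 2 = -1 := by
      rw [← mul_inv_cancel_left S h, hcomm.mul_pow, hS,
        sq_eq_one_of_mem_negIdSubgroup ⟨k, hk⟩, mul_one]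
    rw [qPGL_ker, negIdSubgroup, Subgroup.zpowers_le, ← hsq]
    exact H.pow_mem hh 2
  rw [← Subgroup.comap_map_eq_self hker, hH, Subgroup.comap_top]

/-- `PGL₂(ℤ)` cannot be generated by two elements of finite order.  (This is proved
assuming Du's theorem that `GL₂(ℤ)` cannot be generated by two elements of finite
order, which is taken here as a hypothesis.) -/
theorem pgl2z_not_generated_by_two_torsion
    (hDu : ¬ ∃ A B : GL2Z, IsOfFinOrder A ∧ IsOfFinOrder B ∧
      Subgroup.closure {A, B} = (⊤ : Subgroup GL2Z)) :
    ¬ ∃ x y : PGL2Z, IsOfFinOrder x ∧ IsOfFinOrder y ∧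
      Subgroup.closure {x, y} = (⊤ : Subgroup PGL2Z) := by
  rintro ⟨x, y, hx, hy, hxy⟩
  obtain ⟨A, rfl⟩ := qPGL_surjective x
  obtain ⟨B, rfl⟩ := qPGL_surjective y
  refine hDu ⟨A, B, isOfFinOrder_of_qPGL hx, isOfFinOrder_of_qPGL hy,
    eq_top_of_map_qPGL_eq_top ?_⟩
  rw [MonoidHom.map_closure, Set.image_pair, hxy]
end
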